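/- arXiv:2206.01827 — 2 statements merged into one kernel-verified Lean document; each statement's English description precedes it below -/
import Mathlib

section
/- Let χ > 0 and let η : [0,1] → ℝ be continuous and strictly decreasing with η(0) = 1 and η(1) = 0. For each n ∈ ℕ let η_n : {1,…,n} → [0,1] be nonincreasing with max_{1≤ℓ≤n} |η_n(ℓ) − η(ℓ/n)| → 0 as n → ∞, and set v_n := (1/n) Σ_{ℓ=1}^n η_n(ℓ). Then there exist constants C > 0, ε > 0 and n̄ ∈ ℕ such that for every n ≥ n̄ and every w ∈ ℝⁿ with w₁ ≤ ⋯ ≤ w_n, Σ_{i=1}^n w_i = 0, and (1/n) Σ_{i=1}^n |w_i|^{1+χ} ≥ C, one has (2+χ) · (1/n) Σ_{i=1}^n (η_n(i) − v_n) · sgn(w_i) · |w_i|^{1+χ} ≤ −ε · (1/n) Σ_{i=1}^n |w_i|^{1+χ}. -/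
open MeasureTheory Filter Set ENNReal NNReal

/-- sign: `1` if `0 ≤ y`, `-1` otherwise. -/
noncomputable def sgn (y : ℝ) : ℝ := if 0 ≤ y then 1 else -1

/-- The odd extension of `y ↦ y ^ p` to the real line. -/
noncomputable def signedRpow (p y : ℝ) : ℝ := sgn y * |y| ^ p

lemma signedRpow_of_nonneg (p : ℝ) {y : ℝ} (hy : 0 ≤ y) : signedRpow p y = y ^ p := by
  simp [signedRpow, sgn, hy, abs_of_nonneg hy]

lemma signedRpow_of_neg (p : ℝ) {y : ℝ} (hy : y < 0) : signedRpow p y = -(-y) ^ p := by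
  simp [signedRpow, sgn, not_le.2 hy, abs_of_neg hy]

lemma signedRpow_neg {p : ℝ} (hp : 0 < p) (y : ℝ) : signedRpow p (-y) = -signedRpow p y := by
  rcases lt_trichotomy y 0 with hy | rfl | hy
  · rw [signedRpow_of_neg p hy, signedRpow_of_nonneg p (by linarith), neg_neg]
  · simp [signedRpow_of_nonneg p le_rfl, Real.zero_rpow hp.ne']
  · rw [signedRpow_of_nonneg p hy.le, signedRpow_of_neg p (by linarith), neg_neg]

lemma abs_signedRpow (p y : ℝ) : |signedRpow p y| = |y| ^ p := by
  have h : 0 ≤ |y| ^ p := by positivity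
  unfold signedRpow sgn
  split_ifs <;> simp [abs_of_nonneg h]

lemma signedRpow_mul_of_nonneg (p : ℝ) {u : ℝ} (hu : 0 < u) (z : ℝ) :
    signedRpow p (u * z) = signedRpow p u * signedRpow p z := by
  rw [signedRpow_of_nonneg p hu.le]
  rcases lt_or_ge z 0 with hz | hz
  · rw [signedRpow_of_neg p hz, signedRpow_of_neg p (mul_neg_of_pos_of_neg hu hz), ← mul_neg,
      Real.mul_rpow hu.le (by linarith)]
    ring
  · rw [signedRpow_of_nonneg p hz, signedRpow_of_nonneg p (by positivity),
      Real.mul_rpow hu.le hz]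

lemma signedRpow_monotone {p : ℝ} (hp : 0 ≤ p) : Monotone (signedRpow p) := by
  intro a b hab
  rcases lt_or_ge a 0 with ha | ha
  · rw [signedRpow_of_neg p ha]
    rcases lt_or_ge b 0 with hb | hb
    · rw [signedRpow_of_neg p hb]
      exact neg_le_neg (Real.rpow_le_rpow (by linarith) (by linarith) hp)
    · rw [signedRpow_of_nonneg p hb]
      have h1 : 0 ≤ (-a) ^ p := Real.rpow_nonneg (by linarith) p
      have h2 : 0 ≤ b ^ p := Real.rpow_nonneg hb p
      linarith
  · rw [signedRpow_of_nonneg p ha, signedRpow_of_nonneg p (ha.trans hab)]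
    exact Real.rpow_le_rpow ha hab hp

lemma one_sub_le_two_mul_abs_one_sub_signedRpow {p : ℝ} (hp : 1 ≤ p) (z : ℝ) :
    1 - z ≤ 2 * |1 - signedRpow p z| := by
  rcases lt_or_ge z 0 with hz | hz
  · rw [signedRpow_of_neg p hz]
    have h0 : 0 ≤ (-z) ^ p := Real.rpow_nonneg (by linarith) p
    have h := le_abs_self (1 - -(-z) ^ p)
    rcases le_total (-z) 1 with h1 | h1
    · linarith
    · have := Real.self_le_rpow_of_one_le h1 hp
      linarith
  · rw [signedRpow_of_nonneg p hz]
    rcases le_total z 1 with h1 | h1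
    · have h2 := Real.rpow_le_self_of_le_one hz h1 hp
      have := le_abs_self (1 - z ^ p)
      linarith
    · have := abs_nonneg (1 - z ^ p)
      linarith

lemma abs_signedRpow_mul_one_sub_div_le {p : ℝ} (hp : 1 ≤ p) {u : ℝ} (hu : u ≠ 0) (w : ℝ) :
    |signedRpow p u| * (1 - w / u) ≤ 2 * |signedRpow p u - signedRpow p w| := by
  have key : ∀ u : ℝ, 0 < u → ∀ w : ℝ,
      |signedRpow p u| * (1 - w / u) ≤ 2 * |signedRpow p u - signedRpow p w| := by
    intro u hu w
    have hw : signedRpow p w = signedRpow p u * signedRpow p (w / u) := by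
      rw [← signedRpow_mul_of_nonneg p hu, mul_div_cancel₀ _ hu.ne']
    have h := one_sub_le_two_mul_abs_one_sub_signedRpow hp (w / u)
    have e : signedRpow p u - signedRpow p w = signedRpow p u * (1 - signedRpow p (w / u)) := by
      rw [hw]; ring
    rw [e, abs_mul]
    nlinarith [mul_le_mul_of_nonneg_left h (abs_nonneg (signedRpow p u))]
  rcases lt_or_gt_of_ne hu with hu | hu
  · have h := key (-u) (by linarith) (-w)
    rw [signedRpow_neg (by linarith), signedRpow_neg (by linarith), abs_neg, neg_div_neg_eq,
      ← neg_sub', abs_neg] at h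
    exact h
  · exact key u hu w

lemma sum_abs_signedRpow_le {ι : Type*} [Fintype ι] {p : ℝ} (hp : 1 ≤ p) {w : ι → ℝ}
    (hw : ∑ i, w i = 0) (u : ℝ) :
    ∑ i, |w i| ^ p ≤ 3 * ∑ i, |signedRpow p u - signedRpow p (w i)| := by
  have h1 : Fintype.card ι * |signedRpow p u| ≤
      2 * ∑ i, |signedRpow p u - signedRpow p (w i)| := by
    rcases eq_or_ne u 0 with rfl | hu
    · rw [abs_signedRpow, abs_zero, Real.zero_rpow (by linarith), mul_zero]
      positivity
    · calc Fintype.card ι * |signedRpow p u|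
          = ∑ i, |signedRpow p u| * (1 - w i / u) := by
            rw [← Finset.mul_sum, Finset.sum_sub_distrib, ← Finset.sum_div, hw]
            simp [mul_comm]
        _ ≤ ∑ i, 2 * |signedRpow p u - signedRpow p (w i)| :=
            Finset.sum_le_sum fun i _ => abs_signedRpow_mul_one_sub_div_le hp hu (w i)
        _ = _ := by rw [Finset.mul_sum]
  calc ∑ i, |w i| ^ p
      ≤ ∑ i, (|signedRpow p u| + |signedRpow p u - signedRpow p (w i)|) := by
        refine Finset.sum_le_sum fun i _ => ?_
        rw [← abs_signedRpow, abs_sub_comm]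
        have := abs_add_le (signedRpow p u) (signedRpow p (w i) - signedRpow p u)
        rwa [add_sub_cancel] at this
    _ ≤ _ := by
        rw [Finset.sum_add_distrib, Finset.sum_const, Finset.card_univ, nsmul_eq_mul]
        linarith

/-- A Chebyshev-type inequality: the covariance of an antitone centred sequence and a monotone
sequence is controlled by the deviation of the latter from one of its values. -/
lemma exists_sum_abs_mul_sum_abs_sub_le {n : ℕ} (hn : 0 < n) {a x : Fin n → ℝ} (ha : Antitone a)
    (ha0 : ∑ i, a i = 0) (hx : Monotone x) :
    ∃ m, (∑ i, |a i|) * ∑ i, |x m - x i| ≤ 2 * (n * -∑ i, a i * x i) := by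
  classical
  let S : Finset (Fin n) := Finset.univ.filter fun i => 0 ≤ a i
  have hS : S.Nonempty := by
    by_contra h
    have h' : ∀ i, a i < 0 := by
      intro i
      by_contra hi
      exact h ⟨i, by simp [S, not_lt.1 hi]⟩
    have : ∑ i, a i < 0 := Finset.sum_neg (fun i _ => h' i) ⟨⟨0, hn⟩, Finset.mem_univ _⟩
    linarith
  let m := S.max' hS
  have hmS : 0 ≤ a m := by
    have := S.max'_mem hS
    exact (Finset.mem_filter.1 this).2
  have hxS : ∀ i ∈ S, x i ≤ x m := fun i hi => hx (S.le_max' i hi)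
  have hxC : ∀ i ∈ Sᶜ, x m ≤ x i := by
    intro i hi
    refine hx (le_of_not_gt fun him => ?_)
    simp only [S, Finset.mem_compl, Finset.mem_filter, Finset.mem_univ, true_and] at hi
    exact hi (hmS.trans (ha him.le))
  have haS : ∀ i ∈ S, 0 ≤ a i := fun i hi => (Finset.mem_filter.1 hi).2
  have haC : ∀ i ∈ Sᶜ, a i ≤ 0 := by
    intro i hi
    simp only [S, Finset.mem_compl, Finset.mem_filter, Finset.mem_univ, true_and, not_le] at hi
    exact hi.le
  have chebyshev : ∀ T : Finset (Fin n), (∀ i ∈ T, 0 ≤ a i * (x m - x i)) →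
      (∑ i ∈ T, a i) * ∑ i ∈ T, (x m - x i) ≤ n * ∑ i ∈ T, a i * (x m - x i) := by
    intro T hT
    have hmono : MonovaryOn a (fun i => x m - x i) T := by
      intro i _ j _ hij
      refine ha (le_of_not_gt fun h => ?_)
      have := hx h.le
      simp only at hij
      linarith
    refine hmono.sum_mul_sum_le_card_mul_sum.trans ?_
    refine mul_le_mul_of_nonneg_right ?_ (Finset.sum_nonneg hT)
    exact_mod_cast (Finset.card_le_univ T).trans_eq (Fintype.card_fin n)
  have h1 := chebyshev S fun i hi => mul_nonneg (haS i hi) (sub_nonneg.2 (hxS i hi))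
  have h2 := chebyshev Sᶜ fun i hi =>
    mul_nonneg_of_nonpos_of_nonpos (haC i hi) (sub_nonpos.2 (hxC i hi))
  have e1 : ∑ i ∈ S, a i + ∑ i ∈ Sᶜ, a i = 0 := by rw [Finset.sum_add_sum_compl, ha0]
  have e2 : ∑ i, |a i| = ∑ i ∈ S, a i - ∑ i ∈ Sᶜ, a i := by
    rw [← Finset.sum_add_sum_compl S, sub_eq_add_neg, ← Finset.sum_neg_distrib]
    exact congrArg₂ _ (Finset.sum_congr rfl fun i hi => abs_of_nonneg (haS i hi))
      (Finset.sum_congr rfl fun i hi => abs_of_nonpos (haC i hi))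
  have e3 : ∑ i, |x m - x i| = ∑ i ∈ S, (x m - x i) - ∑ i ∈ Sᶜ, (x m - x i) := by
    rw [← Finset.sum_add_sum_compl S, sub_eq_add_neg, ← Finset.sum_neg_distrib]
    exact congrArg₂ _
      (Finset.sum_congr rfl fun i hi => abs_of_nonneg (sub_nonneg.2 (hxS i hi)))
      (Finset.sum_congr rfl fun i hi => abs_of_nonpos (sub_nonpos.2 (hxC i hi)))
  have e4 : -∑ i, a i * x i =
      ∑ i ∈ S, a i * (x m - x i) + ∑ i ∈ Sᶜ, a i * (x m - x i) := by
    rw [Finset.sum_add_sum_compl]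
    simp only [mul_sub, Finset.sum_sub_distrib]
    rw [← Finset.sum_mul, ha0]
    ring
  refine ⟨m, ?_⟩
  have e5 : ∑ i ∈ Sᶜ, a i = -∑ i ∈ S, a i := by linarith
  rw [e2, e3, e4]
  rw [e5] at h2 ⊢
  linarith

/-- If the first and last quarters of a sequence differ by `d`, its mean absolute deviation from
any value is bounded below by a multiple of `d`. -/
lemma card_mul_le_sum_abs_sub {n : ℕ} (hn : 8 ≤ n) {b : Fin n → ℝ} {d : ℝ} (hd : 0 ≤ d)
    (hb : ∀ i : Fin n, 4 * (i.1 + 1) ≤ n → d ≤ b i - b i.rev) (v : ℝ) :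
    n * d ≤ 16 * ∑ i, |b i - v| := by
  have h1 : ∑ i : Fin n, (if 4 * (i.1 + 1) ≤ n then d else 0) ≤
      ∑ i : Fin n, (|b i - v| + |b i.rev - v|) := by
    refine Finset.sum_le_sum fun i _ => ?_
    split_ifs with h
    · have h2 := hb i h
      have h3 := le_abs_self (b i - v)
      have h4 := neg_le_abs (b i.rev - v)
      linarith
    · positivity
  have h2 : ∑ i : Fin n, |b i.rev - v| = ∑ i, |b i - v| :=
    Equiv.sum_comp Fin.revPerm fun i => |b i - v|
  have h3 : ((n / 4 : ℕ) : ℝ) * d ≤ ∑ i : Fin n, (if 4 * (i.1 + 1) ≤ n then d else 0) := by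
    rw [Fin.sum_univ_eq_sum_range (fun i => if 4 * (i + 1) ≤ n then d else 0) n]
    calc ((n / 4 : ℕ) : ℝ) * d
        = ∑ i ∈ Finset.range (n / 4), (if 4 * (i + 1) ≤ n then d else 0) := by
          rw [Finset.sum_congr rfl fun i hi => if_pos (by have := Finset.mem_range.1 hi; omega)]
          simp
      _ ≤ _ := Finset.sum_le_sum_of_subset_of_nonneg
          (Finset.range_subset_range.2 (Nat.div_le_self n 4))
          fun i _ _ => by split_ifs <;> simp [hd]
  have h4 : (n : ℝ) ≤ 8 * ((n / 4 : ℕ) : ℝ) := by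
    have : n ≤ 8 * (n / 4) := by omega
    exact_mod_cast this
  rw [Finset.sum_add_distrib, h2] at h1
  nlinarith [mul_le_mul_of_nonneg_right h4 hd]

theorem drift_functional_negative_for_large_moment
    (χ : ℝ) (hχ : 0 < χ)
    (η : ℝ → ℝ)
    (hη_cont : ContinuousOn η (Set.Icc 0 1))
    (hη_anti : StrictAntiOn η (Set.Icc 0 1))
    (hη0 : η 0 = 1) (hη1 : η 1 = 0)
    (ηn : (n : ℕ) → Fin n → ℝ)
    (hηn_mem : ∀ n, ∀ ℓ : Fin n, ηn n ℓ ∈ Set.Icc (0:ℝ) 1)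
    (hηn_anti : ∀ n, ∀ i j : Fin n, i ≤ j → ηn n j ≤ ηn n i)
    (hηn_conv : Filter.Tendsto
      (fun n => ⨆ ℓ : Fin n, |ηn n ℓ - η ((ℓ.1 + 1 : ℝ) / n)|) Filter.atTop (nhds 0)) :
    ∃ C : ℝ, 0 < C ∧ ∃ ε : ℝ, 0 < ε ∧ ∃ N : ℕ, ∀ n, N ≤ n →
      ∀ w : Fin n → ℝ, Monotone w → (∑ i, w i) = 0 →
        C ≤ (1 / n) * ∑ i, |w i| ^ (1 + χ) →
        (2 + χ) * ((1 / n) * ∑ i, (ηn n i - (1 / n) * ∑ ℓ, ηn n ℓ) * sgn (w i) * |w i| ^ (1 + χ))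
          ≤ -ε * ((1 / n) * ∑ i, |w i| ^ (1 + χ)) := by
  set d := (η (1 / 4) - η (3 / 4)) / 2 with hd
  have hd0 : 0 < d := by
    have := hη_anti (show (1 / 4 : ℝ) ∈ Set.Icc 0 1 by norm_num)
      (show (3 / 4 : ℝ) ∈ Set.Icc 0 1 by norm_num) (by norm_num)
    linarith
  obtain ⟨N, hN⟩ := eventually_atTop.1 (hηn_conv.eventually_le_const (half_pos hd0))
  refine ⟨1, one_pos, d / 96, by positivity, max N 8, fun n hn w hw hw0 _ => ?_⟩
  have hn8 : 8 ≤ n := (le_max_right _ _).trans hn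
  have hnpos : (0 : ℝ) < n := by exact_mod_cast (by omega : 0 < n)
  have hclose : ∀ ℓ : Fin n, |ηn n ℓ - η ((ℓ.1 + 1 : ℝ) / n)| ≤ d / 2 := fun ℓ =>
    (le_ciSup (f := fun ℓ : Fin n => |ηn n ℓ - η ((ℓ.1 + 1 : ℝ) / n)|)
      (Set.finite_range _).bddAbove ℓ).trans (hN n ((le_max_left _ _).trans hn))
  set v := (1 / n : ℝ) * ∑ ℓ, ηn n ℓ with hv
  have hgap : ∀ i : Fin n, 4 * (i.1 + 1) ≤ n → d ≤ ηn n i - ηn n i.rev := by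
    intro i hi
    have hi' : (4 : ℝ) * (i.1 + 1) ≤ n := by exact_mod_cast hi
    have hi0 : (0 : ℝ) ≤ i.1 := Nat.cast_nonneg _
    have hrev : ((i.rev.1 : ℕ) : ℝ) + 1 = n - i.1 := by
      have : i.rev.1 + 1 + i.1 = n := by rw [Fin.val_rev]; omega
      rw [eq_sub_iff_add_eq]
      exact_mod_cast this
    have h1 := abs_le.1 (hclose i)
    have h2 := abs_le.1 (hclose i.rev)
    rw [hrev] at h2
    have h3 : η (1 / 4) ≤ η ((i.1 + 1 : ℝ) / n) := by
      have : (i.1 + 1 : ℝ) / n ≤ 1 / 4 := by rw [div_le_iff₀ hnpos]; linarith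
      exact hη_anti.antitoneOn ⟨by positivity, by linarith⟩ (by norm_num) this
    have h4 : η ((n - i.1 : ℝ) / n) ≤ η (3 / 4) := by
      have : 3 / 4 ≤ (n - i.1 : ℝ) / n := by rw [le_div_iff₀ hnpos]; linarith
      exact hη_anti.antitoneOn (by norm_num)
        ⟨by linarith, by rw [div_le_one hnpos]; linarith⟩ this
    linarith
  have hmean := card_mul_le_sum_abs_sub hn8 hd0.le hgap v
  have hcentred : ∑ i, (ηn n i - v) = 0 := by
    rw [Finset.sum_sub_distrib, Finset.sum_const, Finset.card_univ, Fintype.card_fin,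
      nsmul_eq_mul, hv]
    field_simp
    ring
  obtain ⟨m, hm⟩ := exists_sum_abs_mul_sum_abs_sub_le (by omega : 0 < n)
    (a := fun i => ηn n i - v) (x := fun i => signedRpow (1 + χ) (w i))
    (fun i j hij => sub_le_sub_right (hηn_anti n i j hij) v) hcentred
    ((signedRpow_monotone (by linarith)).comp hw)
  have hsum := sum_abs_signedRpow_le (by linarith : 1 ≤ 1 + χ) hw0 (w m)
  simp only [mul_assoc]
  change (2 + χ) * ((1 / n) * ∑ i, (ηn n i - v) * signedRpow (1 + χ) (w i)) ≤ _
  set A := ∑ i, |ηn n i - v|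
  set D := ∑ i, |signedRpow (1 + χ) (w m) - signedRpow (1 + χ) (w i)|
  set T := ∑ i, (ηn n i - v) * signedRpow (1 + χ) (w i)
  set M := ∑ i, |w i| ^ (1 + χ)
  have hM : 0 ≤ M := Finset.sum_nonneg fun i _ => Real.rpow_nonneg (abs_nonneg _) _
  have hD : 0 ≤ D := by linarith
  have hT : d / 96 * M ≤ -T := by
    have h1 : n * d * D ≤ 16 * (2 * (n * -T)) := by
      nlinarith [mul_le_mul_of_nonneg_right hmean hD]
    have h2 : d * D ≤ 32 * -T := by
      refine le_of_mul_le_mul_left ?_ hnpos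
      linarith
    nlinarith [mul_le_mul_of_nonneg_left hsum hd0.le]
  have hT0 : 0 ≤ -T := le_trans (by positivity) hT
  calc (2 + χ) * (1 / n * T) = -(1 / n * ((2 + χ) * -T)) := by ring
    _ ≤ -(1 / n * (d / 96 * M)) := by
        refine neg_le_neg (mul_le_mul_of_nonneg_left ?_ (by positivity))
        nlinarith
    _ = -(d / 96) * (1 / n * M) := by ring
end

section
/- For every χ > 0 there exists a constant C₆ > 0 such that for all y, δ ∈ ℝ: |y + δ|^{2+χ} − |y|^{2+χ} ≤ (2+χ) · sgn(y) · |y|^{1+χ} · δ + C₆ · |y|^χ · δ² + C₆ · |δ|^{2+χ}. -/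
/-- The tangent line inequality for the convex function `x ↦ x ^ (1 + r)`. -/
lemma rpow_one_add_sub_le {r a b : ℝ} (hr : 0 < r) (ha : 0 ≤ a) (hb : 0 ≤ b) :
    a ^ (1 + r) - b ^ (1 + r) ≤ (1 + r) * a ^ r * (a - b) := by
  rcases ha.eq_or_lt with rfl | ha
  · rw [Real.zero_rpow hr.ne', Real.zero_rpow (by positivity)]
    have := Real.rpow_nonneg hb (1 + r)
    linarith
  · have hs : -1 ≤ b / a - 1 := by
      have : 0 ≤ b / a := by positivity
      linarith
    have h := one_add_mul_self_le_rpow_one_add hs (by linarith : (1 : ℝ) ≤ 1 + r)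
    rw [add_sub_cancel, Real.div_rpow hb ha.le, le_div_iff₀ (by positivity),
      Real.rpow_add ha, Real.rpow_one] at h
    rw [Real.rpow_add ha, Real.rpow_one]
    have e : (1 + (1 + r) * (b / a - 1)) * (a * a ^ r)
        = a * a ^ r - (1 + r) * a ^ r * (a - b) := by
      field_simp
      ring
    linarith

lemma rpow_one_add_sub_mul_sub_le {r a b m : ℝ} (hr : 0 < r) (ha : 0 ≤ a) (hb : 0 ≤ b)
    (ham : a ≤ m) (hbm : b ≤ m) :
    (a ^ (1 + r) - b ^ (1 + r)) * (a - b) ≤ (1 + r) * m ^ r * (a - b) ^ 2 := by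
  wlog hab : b ≤ a generalizing a b
  · have := this hb ha hbm ham (le_of_not_ge hab)
    linarith
  calc (a ^ (1 + r) - b ^ (1 + r)) * (a - b)
      ≤ ((1 + r) * a ^ r * (a - b)) * (a - b) :=
        mul_le_mul_of_nonneg_right (rpow_one_add_sub_le hr ha hb) (sub_nonneg.2 hab)
    _ = (1 + r) * a ^ r * (a - b) ^ 2 := by ring
    _ ≤ (1 + r) * m ^ r * (a - b) ^ 2 := by gcongr

lemma add_rpow_le_two_rpow_mul {r a b : ℝ} (hr : 0 < r) (ha : 0 ≤ a) (hb : 0 ≤ b) :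
    (a + b) ^ r ≤ 2 ^ r * (a ^ r + b ^ r) := by
  wlog hab : b ≤ a generalizing a b
  · have := this hb ha (le_of_not_ge hab)
    rwa [add_comm b, add_comm (b ^ r)] at this
  calc (a + b) ^ r ≤ (2 * a) ^ r := by gcongr; linarith
    _ = 2 ^ r * a ^ r := Real.mul_rpow (by norm_num) ha
    _ ≤ 2 ^ r * (a ^ r + b ^ r) := by
      gcongr
      linarith [Real.rpow_nonneg hb r]

lemma rpow_increment_le_of_nonneg {χ y : ℝ} (hχ : 0 < χ) (hy : 0 ≤ y) (δ : ℝ) :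
    |y + δ| ^ (2 + χ) - y ^ (2 + χ) ≤ (2 + χ) * y ^ (1 + χ) * δ
      + ((2 + χ) * (1 + χ) * 2 ^ χ + (3 + χ)) * y ^ χ * δ ^ 2
      + ((2 + χ) * (1 + χ) * 2 ^ χ + (3 + χ)) * |δ| ^ (2 + χ) := by
  have hyχ := Real.rpow_nonneg hy χ
  have hδχ := Real.rpow_nonneg (abs_nonneg δ) (2 + χ)
  have hC : 0 ≤ (2 + χ) * (1 + χ) * 2 ^ χ := by positivity
  rcases le_or_gt 0 (y + δ) with h | h
  · rw [abs_of_nonneg h]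
    have h1 := rpow_one_add_sub_le (r := 1 + χ) (by linarith) h hy
    have h2 := rpow_one_add_sub_mul_sub_le (m := y + |δ|) hχ h hy
      (by linarith [le_abs_self δ]) (by linarith [abs_nonneg δ])
    have h3 := add_rpow_le_two_rpow_mul hχ hy (abs_nonneg δ)
    have h4 : |δ| ^ (2 + χ) = |δ| ^ χ * δ ^ 2 := by
      rw [add_comm, Real.rpow_add_of_nonneg (abs_nonneg δ) hχ.le (by norm_num),
        Real.rpow_two, sq_abs]
    rw [show 1 + (1 + χ) = 2 + χ by ring, add_sub_cancel_left] at h1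
    rw [add_sub_cancel_left] at h2
    have h5 : (2 + χ) * ((1 + χ) * (y + |δ|) ^ χ * δ ^ 2)
        ≤ (2 + χ) * ((1 + χ) * (2 ^ χ * (y ^ χ + |δ| ^ χ)) * δ ^ 2) := by gcongr
    have h6 := mul_le_mul_of_nonneg_left h2 (by linarith : 0 ≤ 2 + χ)
    have h7 : 0 ≤ (3 + χ) * (y ^ χ * δ ^ 2) := by positivity
    have h8 : 0 ≤ (3 + χ) * |δ| ^ (2 + χ) := by positivity
    rw [h4] at h8 ⊢
    linarith
  · have hδ : |δ| = -δ := abs_of_neg (by linarith)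
    have h1 : |y + δ| ^ (2 + χ) ≤ |δ| ^ (2 + χ) := by
      gcongr 1
      rw [abs_of_neg h, hδ]
      linarith
    have h2 : y ^ (1 + χ) * |δ| ≤ |δ| ^ (2 + χ) := by
      rw [show 2 + χ = (1 + χ) + 1 by ring,
        Real.rpow_add_of_nonneg (abs_nonneg δ) (by linarith) (by norm_num), Real.rpow_one]
      gcongr
      linarith
    have h3 := mul_le_mul_of_nonneg_left h2 (by linarith : 0 ≤ 2 + χ)
    have h4 : (2 + χ) * (y ^ (1 + χ) * |δ|) = -((2 + χ) * y ^ (1 + χ) * δ) := by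
      rw [hδ]
      ring
    have h5 : 0 ≤ ((2 + χ) * (1 + χ) * 2 ^ χ + (3 + χ)) * y ^ χ * δ ^ 2 := by positivity
    have h6 := mul_nonneg hC hδχ
    have h7 := Real.rpow_nonneg hy (2 + χ)
    linarith

theorem rpow_increment_inequality (χ : ℝ) (hχ : 0 < χ) :
    ∃ C₆ : ℝ, 0 < C₆ ∧ ∀ y δ : ℝ,
      |y + δ| ^ (2 + χ) - |y| ^ (2 + χ)
        ≤ (2 + χ) * sgn y * |y| ^ (1 + χ) * δ + C₆ * |y| ^ χ * δ ^ 2 + C₆ * |δ| ^ (2 + χ) := by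
  refine ⟨(2 + χ) * (1 + χ) * 2 ^ χ + (3 + χ), by positivity, fun y δ => ?_⟩
  rcases le_or_gt 0 y with hy | hy
  · rw [sgn, if_pos hy, abs_of_nonneg hy, mul_one]
    exact rpow_increment_le_of_nonneg hχ hy δ
  · rw [sgn, if_neg hy.not_ge, abs_of_neg hy]
    have h := rpow_increment_le_of_nonneg hχ (neg_nonneg.2 hy.le) (-δ)
    rw [← neg_add, abs_neg, abs_neg, neg_sq] at h
    linarith
end
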